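/- Let (Ω, P) be a probability space, λ, C, θ > 0, T̄ ≥ 0, k, K ≥ 1 integers, and τ := θK/(θK + 1). Let t : Ω → ℝ be a nonnegative integrable random variable with E[t] ≤ T̄, and let N : Ω → ℕ be a measurable integrable random variable such that almost surely, if N ≥ 1 then λ k τ^{N−1} t > C. Then E[N] ≤ (θK + 1)·ln(T̄ λ k / C + 1) + 1. -/

import Mathlib

open MeasureTheory

/-- The tangent line of `Real.log` at `c` lies above its graph. -/
theorem log_le_log_add_div_sub_one {x c : ℝ} (hx : 0 < x) (hc : 0 < c) :
    Real.log x ≤ Real.log c + (x / c - 1) := by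
  have h := Real.log_le_sub_one_of_pos (div_pos hx hc)
  rw [Real.log_div hx.ne' hc.ne'] at h
  linarith

/-- If `n ≥ 1` forces `τ ^ (n - 1) * y > 1`, where `τ = 1 - 1 / m`, then
`n ≤ m * log (y + 1) + 1`. -/
theorem natCast_le_mul_log_add_one {m τ y : ℝ} {n : ℕ} (hm : 0 < m) (hτ : 0 < τ)
    (hmτ : m * (1 - τ) = 1) (hy : 0 ≤ y) (h : 1 ≤ n → 1 < τ ^ (n - 1) * y) :
    (n : ℝ) ≤ m * Real.log (y + 1) + 1 := by
  cases n with
  | zero =>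
    have := mul_nonneg hm.le (Real.log_nonneg (show 1 ≤ y + 1 by linarith))
    push_cast
    linarith
  | succ n =>
    have h1 : 1 < τ ^ n * y := by simpa using h (by omega)
    have hypos : 0 < y := pos_of_mul_pos_right (one_pos.trans h1) (pow_pos hτ n).le
    have h2 := Real.log_pos h1
    rw [Real.log_mul (pow_pos hτ n).ne' hypos.ne', Real.log_pow] at h2
    have h3 : Real.log y ≤ Real.log (y + 1) := Real.log_le_log hypos (by linarith)
    have h4 : (n : ℝ) * Real.log τ ≤ n * (τ - 1) :=
      mul_le_mul_of_nonneg_left (Real.log_le_sub_one_of_pos hτ) n.cast_nonneg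
    have h5 : m * (n * (1 - τ)) ≤ m * Real.log (y + 1) :=
      mul_le_mul_of_nonneg_left (by linarith) hm.le
    have h6 : m * (n * (1 - τ)) = n := by linear_combination (n : ℝ) * hmτ
    push_cast
    linarith

/-- Expected cycle-length bound of Theorem 2.2(a): under rule (B2), if almost surely
`λ k τ^{N−1} t > C` whenever `N ≥ 1`, and `E[t] ≤ T̄`, then
`E[N] ≤ (θK + 1)·ln(T̄ λ k / C + 1) + 1`. -/
theorem stmt14 {Ω : Type*} [MeasurableSpace Ω] {P : Measure Ω} [IsProbabilityMeasure P]
    (lam C θ : ℝ) (hlam : 0 < lam) (hC : 0 < C) (hθ : 0 < θ)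
    (Tbar : ℝ) (hTbar : 0 ≤ Tbar)
    (k K : ℕ) (hk : 1 ≤ k) (hK : 1 ≤ K)
    (τ : ℝ) (hτ : τ = θ * K / (θ * K + 1))
    (t : Ω → ℝ) (ht0 : ∀ᵐ ω ∂P, 0 ≤ t ω) (htint : Integrable t P)
    (htT : ∫ ω, t ω ∂P ≤ Tbar)
    (N : Ω → ℕ) (hNmeas : Measurable N)
    (hNint : Integrable (fun ω => (N ω : ℝ)) P)
    (hNgt : ∀ᵐ ω ∂P, 1 ≤ N ω → lam * k * τ ^ (N ω - 1) * t ω > C) :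
    ∫ ω, (N ω : ℝ) ∂P ≤ (θ * K + 1) * Real.log (Tbar * lam * k / C + 1) + 1 := by
  have hk0 : (0 : ℝ) < k := by exact_mod_cast hk
  have hK0 : (0 : ℝ) < K := by exact_mod_cast hK
  have hm : 0 < θ * K + 1 := by positivity
  have hτ0 : 0 < τ := by rw [hτ]; positivity
  have hmτ : (θ * K + 1) * (1 - τ) = 1 := by rw [hτ]; field_simp; ring
  set m := θ * K + 1
  set a := lam * k / C with ha
  have ha0 : 0 < a := by positivity
  have hc : 0 < a * Tbar + 1 := by positivity
  rw [show Tbar * lam * k / C + 1 = a * Tbar + 1 by rw [ha]; ring]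
  set c := a * Tbar + 1 with hcdef
  have hpt : ∀ᵐ ω ∂P, (N ω : ℝ) ≤ m * a / c * t ω + (m * (Real.log c + (1 / c - 1)) + 1) := by
    filter_upwards [ht0, hNgt] with ω h0 h
    have hN := natCast_le_mul_log_add_one (n := N ω) hm hτ0 hmτ (mul_nonneg ha0.le h0)
      fun h1 => by
        rw [show τ ^ (N ω - 1) * (a * t ω) = lam * k * τ ^ (N ω - 1) * t ω / C by
          rw [ha]; ring, one_lt_div hC]
        exact h h1
    have hlog := mul_le_mul_of_nonneg_left
      (log_le_log_add_div_sub_one (show 0 < a * t ω + 1 by positivity) hc) hm.le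
    calc (N ω : ℝ) ≤ m * (Real.log c + ((a * t ω + 1) / c - 1)) + 1 := by linarith
      _ = _ := by ring
  have hint := htint.const_mul (m * a / c)
  calc ∫ ω, (N ω : ℝ) ∂P
      ≤ ∫ ω, (m * a / c * t ω + (m * (Real.log c + (1 / c - 1)) + 1)) ∂P :=
        integral_mono_ae hNint (hint.add (integrable_const _)) hpt
    _ = m * a / c * ∫ ω, t ω ∂P + (m * (Real.log c + (1 / c - 1)) + 1) := by
        rw [integral_add hint (integrable_const _), integral_const_mul]
        simp
    _ ≤ m * a / c * Tbar + (m * (Real.log c + (1 / c - 1)) + 1) := by gcongr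
    _ = m * Real.log c + m * (c / c - 1) + 1 := by
        rw [show c / c = (a * Tbar + 1) / c by rw [← hcdef]]
        ring
    _ = m * Real.log c + 1 := by rw [div_self hc.ne']; ring
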